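/- The function f_{23,a}(τ) := η(τ)³η(23τ)³/(η(2τ)η(46τ)) + 3η(τ)²η(23τ)² + 4η(τ)η(2τ)η(23τ)η(46τ) + 4η(2τ)²η(46τ)² is a cusp form of weight 2 for Γ₀(23): it is holomorphic on ℍ, satisfies f_{23,a}((aτ+b)/(cτ+d)) = (cτ+d)² f_{23,a}(τ) for every (a b; c d) ∈ Γ₀(23), and (cτ+d)^{−2} f_{23,a}(γτ) → 0 as ℑτ → ∞ for every γ ∈ SL₂(ℤ). -/

import Mathlib

noncomputable section

open Complex

/-- `q = e^{2πiτ}`. -/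
def qq (τ : ℂ) : ℂ := exp (2 * ↑Real.pi * I * τ)

/-- The Dedekind eta function `η(τ) = q^{1/24} ∏_{n≥1} (1 − qⁿ)`. -/
def dedekindEta (τ : ℂ) : ℂ := exp (2 * ↑Real.pi * I * τ / 24) * ∏' n : ℕ, (1 - qq τ ^ (n + 1))

/-- `f_{23,a}(τ) = η(τ)³η(23τ)³/(η(2τ)η(46τ)) + 3η(τ)²η(23τ)²
  + 4η(τ)η(2τ)η(23τ)η(46τ) + 4η(2τ)²η(46τ)²`. -/
def f23a (τ : ℂ) : ℂ :=
  dedekindEta τ ^ 3 * dedekindEta (23 * τ) ^ 3 / (dedekindEta (2 * τ) * dedekindEta (46 * τ))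
    + 3 * dedekindEta τ ^ 2 * dedekindEta (23 * τ) ^ 2
    + 4 * dedekindEta τ * dedekindEta (2 * τ) * dedekindEta (23 * τ) * dedekindEta (46 * τ)
    + 4 * dedekindEta (2 * τ) ^ 2 * dedekindEta (46 * τ) ^ 2

/-- The Euler product `∏ (1 - tⁿ)`. -/
def eulerProd (t : ℂ) : ℂ := ∏' n : ℕ, (1 - t ^ (n + 1))

lemma dedekindEta_eq_eta : dedekindEta = ModularForm.eta := by
  funext τ
  simp [dedekindEta, ModularForm.eta, ModularForm.eta_q, qq, Function.Periodic.qParam]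

lemma dedekindEta_ne_zero {τ : ℂ} (hτ : 0 < τ.im) : dedekindEta τ ≠ 0 := by
  rw [dedekindEta_eq_eta]
  exact ModularForm.eta_ne_zero hτ

lemma differentiableAt_dedekindEta {τ : ℂ} (hτ : 0 < τ.im) :
    DifferentiableAt ℂ dedekindEta τ := by
  rw [dedekindEta_eq_eta]
  exact ModularForm.differentiableAt_eta_of_mem_upperHalfPlaneSet hτ

lemma dedekindEta_eq_eulerProd (τ : ℂ) :
    dedekindEta τ = exp (2 * ↑Real.pi * I * τ / 24) * eulerProd (qq τ) := rfl

lemma dedekindEta_add_one (τ : ℂ) :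
    dedekindEta (τ + 1) = exp (2 * ↑Real.pi * I / 24) * dedekindEta τ := by
  have h : qq (τ + 1) = qq τ := by
    rw [qq, qq, mul_add, mul_one, exp_add, exp_two_pi_mul_I, mul_one]
  rw [dedekindEta_eq_eulerProd, dedekindEta_eq_eulerProd, h, mul_add, add_div, exp_add, mul_one]
  ring

lemma dedekindEta_add_nat (τ : ℂ) (n : ℕ) :
    dedekindEta (τ + n) = exp (2 * ↑Real.pi * I / 24) ^ n * dedekindEta τ := by
  induction n with
  | zero => simp
  | succ n ih =>
    rw [Nat.cast_succ, ← add_assoc, dedekindEta_add_one, ih]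
    ring

lemma dedekindEta_neg_one_div {τ : ℂ} (hτ : 0 < τ.im) :
    dedekindEta (-1 / τ) = (sqrt I)⁻¹ * (sqrt τ * dedekindEta τ) := by
  rw [dedekindEta_eq_eta]
  simpa using ModularForm.eta_comp_eq_csqrt_I_inv hτ

lemma sqrt_mul_self (z : ℂ) : sqrt z * sqrt z = z := by
  rcases eq_or_ne z 0 with rfl | hz
  · simp
  · rw [sqrt, ← cpow_add _ _ hz]
    norm_num

lemma ne_zero_of_im_pos {τ : ℂ} (hτ : 0 < τ.im) : τ ≠ 0 := by
  rintro rfl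
  simp at hτ

lemma im_natCast_mul_pos {N : ℕ} (hN : 0 < N) {τ : ℂ} (hτ : 0 < τ.im) : 0 < ((N : ℂ) * τ).im := by
  simpa using mul_pos (Nat.cast_pos.mpr hN) hτ

/-- The product `η(τ)η(Nτ)`. -/
def etaPair (N : ℕ) (τ : ℂ) : ℂ := dedekindEta τ * dedekindEta (N * τ)

lemma etaPair_ne_zero {N : ℕ} (hN : 0 < N) {τ : ℂ} (hτ : 0 < τ.im) : etaPair N τ ≠ 0 :=
  mul_ne_zero (dedekindEta_ne_zero hτ) (dedekindEta_ne_zero (im_natCast_mul_pos hN hτ))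

lemma differentiableAt_etaPair {N : ℕ} (hN : 0 < N) {τ : ℂ} (hτ : 0 < τ.im) :
    DifferentiableAt ℂ (etaPair N) τ :=
  (differentiableAt_dedekindEta hτ).mul <|
    (differentiableAt_dedekindEta (im_natCast_mul_pos hN hτ)).comp τ (by fun_prop)

lemma etaPair_add_one (N : ℕ) (τ : ℂ) :
    etaPair N (τ + 1) = exp (2 * ↑Real.pi * I / 24) ^ (N + 1) * etaPair N τ := by
  rw [etaPair, etaPair, mul_add, mul_one, dedekindEta_add_one, dedekindEta_add_nat]
  ring

lemma exists_etaPair_fricke {N : ℕ} (hN : 0 < N) :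
    ∃ c : ℂ, c ^ 2 = -N ∧ ∀ τ : ℂ, 0 < τ.im → etaPair N (-1 / (N * τ)) = c * τ * etaPair N τ := by
  have hN' : (N : ℂ) ≠ 0 := Nat.cast_ne_zero.mpr hN.ne'
  have hI := sqrt_mul_self I
  have hI0 : sqrt I ≠ 0 := by
    intro h
    simp [h, eq_comm] at hI
  refine ⟨(sqrt I)⁻¹ ^ 2 * sqrt (N : ℂ), ?_, fun τ hτ => ?_⟩
  · have hs : (sqrt I)⁻¹ ^ 4 = -1 := by
      rw [inv_pow, show (4 : ℕ) = 2 * 2 by norm_num, pow_mul, sq (sqrt I), hI]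
      simp
    linear_combination sqrt (N : ℂ) ^ 2 * hs - sqrt_mul_self (N : ℂ)
  · have hτ0 := ne_zero_of_im_pos hτ
    have h1 : (N : ℂ) * (-1 / (N * τ)) = -1 / τ := by field_simp
    have h2 : sqrt ((N : ℂ) * τ) = sqrt (N : ℂ) * sqrt τ := by
      have hlog := log_ofReal_mul (r := N) (Nat.cast_pos.mpr hN) hτ0
      rw [sqrt_eq_exp hN', sqrt_eq_exp hτ0, sqrt_eq_exp (mul_ne_zero hN' hτ0), ← exp_add]
      push_cast at hlog
      rw [hlog]
      ring_nf
    rw [etaPair, h1, dedekindEta_neg_one_div (im_natCast_mul_pos hN hτ),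
      dedekindEta_neg_one_div hτ, h2, etaPair]
    linear_combination (sqrt I)⁻¹ ^ 2 * sqrt (N : ℂ) * (dedekindEta τ * dedekindEta (N * τ)) *
      sqrt_mul_self τ

lemma im_mobius_pos {a b c d : ℤ} (h : a * d - b * c = 1) {τ : ℂ} (hτ : 0 < τ.im) :
    0 < (((a : ℂ) * τ + b) / (c * τ + d)).im := by
  let γ : Matrix.SpecialLinearGroup (Fin 2) ℤ := ⟨!![a, b; c, d], by simpa [Matrix.det_fin_two]⟩
  have him := (γ • (⟨τ, hτ⟩ : UpperHalfPlane)).im_pos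
  rw [← UpperHalfPlane.coe_im, UpperHalfPlane.coe_specialLinearGroup_apply] at him
  simpa [γ] using him

lemma denom_ne_zero_of_det {a b c d : ℤ} (h : a * d - b * c = 1) {τ : ℂ} (hτ : 0 < τ.im) :
    (c : ℂ) * τ + d ≠ 0 := by
  intro h0
  have := im_mobius_pos h hτ
  simp [h0] at this

lemma exists_add_mul_natAbs_le (x : ℤ) {m : ℤ} (hm : m ≠ 0) :
    ∃ n : ℤ, 2 * (x + n * m).natAbs ≤ m.natAbs := by
  have hr := Int.emod_nonneg x hm
  have hr' := Int.emod_lt_abs x hm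
  rw [Int.abs_eq_natAbs] at hr'
  have hx := Int.emod_add_mul_ediv x m
  by_cases h : 2 * (x % m) ≤ m.natAbs
  · refine ⟨-(x / m), ?_⟩
    rw [show x + -(x / m) * m = x % m by linear_combination -hx]
    omega
  · rcases lt_or_gt_of_ne hm with hm' | hm'
    · refine ⟨-(x / m) + 1, ?_⟩
      rw [show x + (-(x / m) + 1) * m = x % m + m by linear_combination -hx]
      omega
    · refine ⟨-(x / m) - 1, ?_⟩
      rw [show x + (-(x / m) - 1) * m = x % m - m by linear_combination -hx]
      omega

/-- Every integer matrix `(a, b; NC, d)` of determinant `1` with `N < 4` is, up to sign, a product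
of the matrices `(1, 1; 0, 1)`, `(1, 0; N, 1)` and their inverses. -/
lemma gammaZero_induction {N : ℕ} (hN : 0 < N) (hN4 : N < 4) (p : ℤ → ℤ → ℤ → ℤ → Prop)
    (hT : ∀ a b C d : ℤ, a * d - b * (N * C) = 1 → (p a b C d ↔ p a (b + a) C (d + N * C)))
    (hU : ∀ a b C d : ℤ, a * d - b * (N * C) = 1 → (p a b C d ↔ p (a + N * b) b (C + d) d))
    (h1 : p 1 0 0 1) (h2 : p (-1) 0 0 (-1)) :
    ∀ a b C d : ℤ, a * d - b * (N * C) = 1 → p a b C d := by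
  have hTn : ∀ (n : ℤ) (a b C d : ℤ), a * d - b * (N * C) = 1 →
      (p a b C d ↔ p a (b + n * a) C (d + n * (N * C))) := by
    intro n
    induction n with
    | zero => simp
    | succ n ih =>
      intro a b C d h
      rw [ih a b C d h, hT _ _ _ _ (by linear_combination h)]
      ring_nf
    | pred n ih =>
      intro a b C d h
      rw [ih a b C d h, hT a (b + (-(n : ℤ) - 1) * a) C _ (by linear_combination h)]
      ring_nf
  have hUn : ∀ (n : ℤ) (a b C d : ℤ), a * d - b * (N * C) = 1 →
      (p a b C d ↔ p (a + n * (N * b)) b (C + n * d) d) := by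
    intro n
    induction n with
    | zero => simp
    | succ n ih =>
      intro a b C d h
      rw [ih a b C d h, hU _ _ _ _ (by linear_combination h)]
      ring_nf
    | pred n ih =>
      intro a b C d h
      rw [ih a b C d h, hU (a + (-(n : ℤ) - 1) * (N * b)) b _ d (by linear_combination h)]
      ring_nf
  have key : ∀ (k : ℕ) (a b C d : ℤ), C.natAbs = k → a * d - b * (N * C) = 1 → p a b C d := by
    intro k
    induction k using Nat.strong_induction_on with
    | _ k ih =>
      intro a b C d hk h
      rcases eq_or_ne C 0 with rfl | hC
      · have had : a * d = 1 := by linear_combination h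
        rcases Int.mul_eq_one_iff_eq_one_or_neg_one.mp had with ⟨rfl, rfl⟩ | ⟨rfl, rfl⟩
        · rw [hTn (-b) _ _ _ _ h]
          simpa using h1
        · rw [hTn b _ _ _ _ h]
          simpa using h2
      · have hNC : (N * C : ℤ) ≠ 0 := mul_ne_zero (by omega) hC
        obtain ⟨n, hn⟩ := exists_add_mul_natAbs_le d hNC
        rw [hTn n a b C d h]
        have h' : a * (d + n * (N * C)) - (b + n * a) * (N * C) = 1 := by linear_combination h
        generalize b + n * a = b' at h'
        generalize d + n * (N * C) = d' at hn h'
        rcases eq_or_ne d' 0 with rfl | hd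
        · have hunit : (N * C) * (-b') = 1 := by linear_combination h'
          have hC1 : IsUnit C := IsUnit.of_mul_eq_one (N * -b') (by linear_combination hunit)
          have hN1 : (N : ℤ) = 1 := by
            have hN1' : IsUnit (N : ℤ) :=
              IsUnit.of_mul_eq_one (C * -b') (by linear_combination hunit)
            rcases Int.isUnit_iff.mp hN1' with h3 | h3 <;> omega
          rw [hT _ _ _ _ h', hUn (-1) _ _ _ _ (by linear_combination h')]
          refine ih _ ?_ _ _ _ _ rfl (by linear_combination h')
          simp only [hN1]
          have := Int.isUnit_iff.mp hC1
          omega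
        · obtain ⟨m, hm⟩ := exists_add_mul_natAbs_le C hd
          rw [hUn m _ _ _ _ h']
          refine ih _ ?_ _ _ _ _ rfl (by linear_combination h')
          rw [Int.natAbs_mul, Int.natAbs_natCast] at hn
          have : N * C.natAbs ≤ 3 * C.natAbs := Nat.mul_le_mul_right _ (by omega)
          omega
  exact fun a b C d h => key _ a b C d rfl h

/-- A function on integer matrices `(a, b; NC, d)` which transforms under `(1, 1; 0, 1)` and
`(1, 0; N, 1)` like the multiplier system of `η(τ)η(Nτ)` is that multiplier system. -/
lemma etaPair_mobius {N : ℕ} (hN : 0 < N) (hN4 : N < 4) (m : ℤ → ℤ → ℤ → ℤ → ℂ)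
    (hT : ∀ a b C d : ℤ, a * d - b * (N * C) = 1 →
      m a (b + a) C (d + N * C) = m a b C d * exp (2 * ↑Real.pi * I / 24) ^ (N + 1))
    (hU : ∀ a b C d : ℤ, a * d - b * (N * C) = 1 →
      m (a + N * b) b (C + d) d * exp (2 * ↑Real.pi * I / 24) ^ (N + 1) = m a b C d)
    (h1 : m 1 0 0 1 = 1) (h2 : m (-1) 0 0 (-1) = -1)
    (a b C d : ℤ) (h : a * d - b * (N * C) = 1) {τ : ℂ} (hτ : 0 < τ.im) :
    etaPair N ((a * τ + b) / (N * C * τ + d)) = (N * C * τ + d) * m a b C d * etaPair N τ := by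
  set ζ := exp (2 * ↑Real.pi * I / 24) ^ (N + 1) with hζdef
  have hζ : ζ ≠ 0 := pow_ne_zero _ (exp_ne_zero _)
  have hN0 : (N : ℂ) ≠ 0 := Nat.cast_ne_zero.mpr hN.ne'
  have hden : ∀ {a b C d : ℤ}, a * d - b * (N * C) = 1 → ∀ {τ : ℂ}, 0 < τ.im →
      (N : ℂ) * C * τ + d ≠ 0 := fun {a b C d} h τ hτ => by
    simpa using denom_ne_zero_of_det h hτ
  have hadd : ∀ τ : ℂ, etaPair N (τ + 1) = ζ * etaPair N τ := etaPair_add_one N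
  have hsub : ∀ τ : ℂ, etaPair N (τ - 1) = ζ⁻¹ * etaPair N τ := fun τ => by
    have := hadd (τ - 1)
    rw [sub_add_cancel] at this
    rw [this, inv_mul_cancel_left₀ hζ]
  obtain ⟨c, hc, hW⟩ := exists_etaPair_fricke hN
  have him : ∀ {τ : ℂ}, 0 < τ.im → 0 < (-1 / ((N : ℂ) * τ)).im := fun {τ} hτ => by
    simpa using im_mobius_pos (a := 0) (b := -1) (c := 1) (d := 0) (by norm_num)
      (im_natCast_mul_pos hN hτ)
  have hdenU : ∀ {τ : ℂ}, 0 < τ.im → (N : ℂ) * τ + 1 ≠ 0 := fun {τ} hτ => by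
    simpa using denom_ne_zero_of_det (a := 1) (b := 0) (c := N) (d := 1) (by norm_num) hτ
  have hdenU' : ∀ {τ : ℂ}, 0 < τ.im → 1 - (N : ℂ) * τ ≠ 0 := fun {τ} hτ => by
    simpa [sub_eq_neg_add] using denom_ne_zero_of_det (a := 1) (b := 0) (c := -N) (d := 1)
      (by norm_num) hτ
  have hUpos : ∀ {τ : ℂ}, 0 < τ.im → 0 < (τ / (N * τ + 1)).im := fun {τ} hτ => by
    simpa using im_mobius_pos (a := 1) (b := 0) (c := N) (d := 1) (by norm_num) hτ
  have hUpos' : ∀ {τ : ℂ}, 0 < τ.im → 0 < (τ / (1 - N * τ)).im := fun {τ} hτ => by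
    simpa [sub_eq_neg_add] using im_mobius_pos (a := 1) (b := 0) (c := -N) (d := 1)
      (by norm_num) hτ
  have hlow : ∀ τ : ℂ, 0 < τ.im →
      etaPair N (τ / (N * τ + 1)) = (N * τ + 1) * ζ⁻¹ * etaPair N τ := by
    intro τ hτ
    have hτ0 := ne_zero_of_im_pos hτ
    have hd := hdenU hτ
    have hσ : 0 < (-1 / ((N : ℂ) * τ) - 1).im := by simpa using him hτ
    have h3 : -1 / (N * (-1 / ((N : ℂ) * τ) - 1)) = τ / (N * τ + 1) := by
      have := ne_zero_of_im_pos hσ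
      rw [div_eq_div_iff (mul_ne_zero hN0 this) hd]
      field_simp
      ring
    rw [← h3, hW _ hσ, hsub, hW _ hτ]
    field_simp
    linear_combination (-1 - (N : ℂ) * τ) * etaPair N τ * hc
  refine gammaZero_induction hN hN4 (fun a b C d => ∀ τ : ℂ, 0 < τ.im →
    etaPair N ((a * τ + b) / (N * C * τ + d)) = (N * C * τ + d) * m a b C d * etaPair N τ)
    ?_ ?_ ?_ ?_ a b C d h τ hτ
  · intro a b C d h
    have hm := hT a b C d h
    constructor
    · intro hp τ hτ
      have h3 := hp (τ + 1) (by simpa using hτ)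
      have harg : ((a : ℂ) * τ + (b + a)) / (N * C * τ + (d + N * C)) =
          (a * (τ + 1) + b) / (N * C * (τ + 1) + d) := by
        congr 1 <;> ring
      push_cast
      rw [harg, h3, hadd, hm]
      ring
    · intro hp τ hτ
      have h3 := hp (τ - 1) (by simpa using hτ)
      have harg : ((a : ℂ) * (τ - 1) + (b + a)) / (N * C * (τ - 1) + (d + N * C)) =
          (a * τ + b) / (N * C * τ + d) := by
        congr 1 <;> ring
      push_cast at h3
      rw [harg, hsub, hm] at h3
      rw [h3]
      field_simp
      ring
  · intro a b C d h
    have hm := hU a b C d h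
    have h' : (a + N * b) * d - b * (N * (C + d)) = 1 := by linear_combination h
    constructor
    · intro hp τ hτ
      have h3 := hp _ (hUpos hτ)
      have hd := hdenU hτ
      have hd2 := hden h (hUpos hτ)
      have hd3 := hden h' hτ
      have harg : ((a + N * b) * τ + b) / ((N : ℂ) * (C + d) * τ + d) =
          (a * (τ / (N * τ + 1)) + b) / (N * C * (τ / (N * τ + 1)) + d) := by
        push_cast at hd3
        rw [div_eq_div_iff hd3 hd2]
        field_simp
        ring
      push_cast
      rw [harg, h3, hlow τ hτ, ← hm]
      field_simp
      ring
    · intro hp τ hτ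
      have hd := hdenU' hτ
      have hd1 := hdenU (hUpos' hτ)
      have hinv : τ / (1 - N * τ) / (N * (τ / (1 - N * τ)) + 1) = τ := by
        have : (N : ℂ) * (τ / (1 - N * τ)) + 1 = (1 - N * τ)⁻¹ := by
          field_simp
          ring
        rw [this, div_inv_eq_mul, div_mul_cancel₀ _ hd]
      have hl := hlow _ (hUpos' hτ)
      have h3 := hp _ (hUpos' hτ)
      have hd2 := hden h hτ
      have hd3 := hden h' (hUpos' hτ)
      rw [hinv] at hl
      have harg : ((a + N * b) * (τ / (1 - N * τ)) + b) /
          ((N : ℂ) * (C + d) * (τ / (1 - N * τ)) + d) = (a * τ + b) / (N * C * τ + d) := by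
        push_cast at hd3
        rw [div_eq_div_iff hd3 hd2]
        field_simp
        ring
      push_cast at h3
      rw [harg] at h3
      rw [h3, hl, ← hm]
      field_simp
      ring
  · simp [h1]
  · simp [h2]

/-- `η(γτ)² = (cτ + d) e^{2πim/12} η(τ)²` for `γ = (a, b; c, d)` and `m` this polynomial. -/
def etaSqExponent {R : Type*} [CommRing R] (a b c d : R) : R :=
  (1 - c ^ 2) * (b * d + 3 * (c - 1) * d + c + 3) + c * (a + d - 3)

/-- `η(γτ)η(2γτ) = (2Cτ + d) e^{2πim/8} η(τ)η(2τ)` for `γ = (a, b; 2C, d)` and `m` this function. -/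
def etaPairTwoExponent (a b C d : ZMod 8) : ZMod 8 :=
  a * C - 2 * C * d + b * d - 2 * b * d * C ^ 2 + 2 * (d - 1) + if d = 3 ∨ d = 5 then 4 else 0

lemma map_etaSqExponent {R S : Type*} [CommRing R] [CommRing S] (f : R →+* S) (a b c d : R) :
    f (etaSqExponent a b c d) = etaSqExponent (f a) (f b) (f c) (f d) := by
  simp [etaSqExponent, map_ofNat f]

lemma etaSqExponent_zmod_three : ∀ a b c d : ZMod 3, a * d - b * c = 1 →
    etaSqExponent a (b + a) c (d + c) = etaSqExponent a b c d + 1 ∧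
    etaSqExponent (a + b) b (c + d) d + 1 = etaSqExponent a b c d ∧
    etaSqExponent a b c d + etaSqExponent a (-b) (-c) d = 0 := by
  unfold etaSqExponent
  decide +kernel

lemma etaSqExponent_zmod_four : ∀ a b c d : ZMod 4, a * d - b * c = 1 →
    etaSqExponent a (b + a) c (d + c) = etaSqExponent a b c d + 1 ∧
    etaSqExponent (a + b) b (c + d) d + 1 = etaSqExponent a b c d ∧
    etaSqExponent a b c d + etaSqExponent a (-b) (-c) d = 0 := by
  unfold etaSqExponent
  decide +kernel

lemma etaSqExponent_zmod_twelve (a b c d : ZMod 12) (h : a * d - b * c = 1) :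
    etaSqExponent a (b + a) c (d + c) = etaSqExponent a b c d + 1 ∧
    etaSqExponent (a + b) b (c + d) d + 1 = etaSqExponent a b c d ∧
    etaSqExponent a b c d + etaSqExponent a (-b) (-c) d = 0 := by
  let f := ZMod.castHom (show 3 ∣ 12 by norm_num) (ZMod 3)
  let g := ZMod.castHom (show 4 ∣ 12 by norm_num) (ZMod 4)
  have inj : ∀ x y : ZMod 12, f x = f y → g x = g y → x = y := by decide +kernel
  have hf := etaSqExponent_zmod_three (f a) (f b) (f c) (f d) (by simpa using congrArg f h)
  have hg := etaSqExponent_zmod_four (g a) (g b) (g c) (g d) (by simpa using congrArg g h)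
  refine ⟨inj _ _ ?_ ?_, inj _ _ ?_ ?_, inj _ _ ?_ ?_⟩ <;>
    simp only [map_add, map_one, map_zero, map_neg, map_etaSqExponent, hf, hg]

lemma etaPairTwoExponent_identities : ∀ a b C d : ZMod 8, a * d - b * (2 * C) = 1 →
    etaPairTwoExponent a (b + a) C (d + 2 * C) = etaPairTwoExponent a b C d + 1 ∧
    etaPairTwoExponent (a + 2 * b) b (C + d) d + 1 = etaPairTwoExponent a b C d ∧
    etaPairTwoExponent a b C d + etaPairTwoExponent a (-b) (-C) d = 0 := by
  unfold etaPairTwoExponent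
  decide +kernel

lemma etaPair_one_mobius (a b c d : ℤ) (h : a * d - b * c = 1) {τ : ℂ} (hτ : 0 < τ.im) :
    etaPair 1 ((a * τ + b) / (c * τ + d)) =
      (c * τ + d) * ZMod.stdAddChar (etaSqExponent (a : ZMod 12) b c d) * etaPair 1 τ := by
  have hζ : exp (2 * ↑Real.pi * I / 24) ^ (1 + 1) = ZMod.stdAddChar (1 : ZMod 12) := by
    have := ZMod.stdAddChar_coe (N := 12) 1
    rw [Int.cast_one] at this
    rw [this, ← exp_nat_mul]
    congr 1
    push_cast
    ring
  have h6 : ZMod.stdAddChar (6 : ZMod 12) = -1 := by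
    have := ZMod.stdAddChar_coe (N := 12) 6
    push_cast at this
    rw [this, ← exp_pi_mul_I]
    congr 1
    ring
  have key := fun a b c d : ℤ => fun h : a * d - b * (1 * c) = 1 =>
    etaSqExponent_zmod_twelve a b c d (by simpa using congrArg (Int.cast : ℤ → ZMod 12) h)
  have := etaPair_mobius (N := 1) (by norm_num) (by norm_num)
    (fun a b c d => ZMod.stdAddChar (etaSqExponent (a : ZMod 12) b c d))
    (fun a b c d h => by
      rw [hζ, ← AddChar.map_add_eq_mul, ← (key a b c d h).1]
      simp)
    (fun a b c d h => by
      rw [hζ, ← AddChar.map_add_eq_mul, ← (key a b c d h).2.1]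
      simp)
    (by
      rw [show etaSqExponent (((1 : ℤ) : ZMod 12)) (0 : ℤ) (0 : ℤ) (1 : ℤ) = 0 by
        decide +kernel, AddChar.map_zero_eq_one])
    (by
      rw [show etaSqExponent (((-1 : ℤ) : ZMod 12)) (0 : ℤ) (0 : ℤ) (-1 : ℤ) = 6 by
        decide +kernel, h6])
    a b c d (by simpa using h) hτ
  simpa using this

lemma etaPair_two_mobius (a b C d : ℤ) (h : a * d - b * (2 * C) = 1) {τ : ℂ} (hτ : 0 < τ.im) :
    etaPair 2 ((a * τ + b) / (2 * C * τ + d)) =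
      (2 * C * τ + d) * ZMod.stdAddChar (etaPairTwoExponent a b C d) * etaPair 2 τ := by
  have hζ : exp (2 * ↑Real.pi * I / 24) ^ (2 + 1) = ZMod.stdAddChar (1 : ZMod 8) := by
    have := ZMod.stdAddChar_coe (N := 8) 1
    rw [Int.cast_one] at this
    rw [this, ← exp_nat_mul]
    congr 1
    push_cast
    ring
  have h4 : ZMod.stdAddChar (4 : ZMod 8) = -1 := by
    have := ZMod.stdAddChar_coe (N := 8) 4
    push_cast at this
    rw [this, ← exp_pi_mul_I]
    congr 1
    ring
  have key := fun a b C d : ℤ => fun h : a * d - b * (2 * C) = 1 =>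
    etaPairTwoExponent_identities a b C d
      (by simpa using congrArg (Int.cast : ℤ → ZMod 8) h)
  have := etaPair_mobius (N := 2) (by norm_num) (by norm_num)
    (fun a b C d => ZMod.stdAddChar (etaPairTwoExponent a b C d))
    (fun a b C d h => by
      rw [hζ, ← AddChar.map_add_eq_mul, ← (key a b C d h).1]
      simp)
    (fun a b C d h => by
      rw [hζ, ← AddChar.map_add_eq_mul, ← (key a b C d h).2.1]
      simp)
    (by
      rw [show etaPairTwoExponent ((1 : ℤ)) (0 : ℤ) (0 : ℤ) (1 : ℤ) = 0 by
        decide +kernel, AddChar.map_zero_eq_one])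
    (by
      rw [show etaPairTwoExponent ((-1 : ℤ)) (0 : ℤ) (0 : ℤ) (-1 : ℤ) = 4 by
        decide +kernel, h4])
    a b C d (by simpa using h) hτ
  simpa using this

lemma mul_mobius (N a b c d τ : ℂ) :
    N * ((a * τ + b) / (N * c * τ + d)) = (a * (N * τ) + N * b) / (c * (N * τ) + d) := by
  rw [← mul_div_assoc]
  congr 1 <;> ring

lemma etaPair_sq_mobius (a b C d : ℤ) (h : a * d - b * (23 * C) = 1) {τ : ℂ} (hτ : 0 < τ.im) :
    etaPair 23 ((a * τ + b) / (23 * C * τ + d)) ^ 2 = (23 * C * τ + d) ^ 2 * etaPair 23 τ ^ 2 := by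
  have hsplit : ∀ τ, etaPair 23 τ ^ 2 = etaPair 1 τ * etaPair 1 (23 * τ) := fun τ => by
    simp only [etaPair]
    push_cast
    ring_nf
  have h1 := etaPair_one_mobius a b (23 * C) d h hτ
  have h2 := etaPair_one_mobius a (23 * b) C d (by linear_combination h) (im_natCast_mul_pos
    (show 0 < 23 by norm_num) hτ)
  have h23 : (23 : ZMod 12) = -1 := by decide
  have hdet : (a : ZMod 12) * d - -b * C = 1 := by
    have := congrArg (Int.cast : ℤ → ZMod 12) h
    push_cast [h23] at this
    linear_combination this
  have hexp := (etaSqExponent_zmod_twelve _ _ _ _ hdet).2.2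
  push_cast [h23] at h1 h2
  simp only [neg_mul, one_mul] at h1 h2
  rw [neg_neg] at hexp
  rw [hsplit, hsplit, h1, mul_mobius, h2]
  have hchar := congrArg ZMod.stdAddChar hexp
  rw [AddChar.map_add_eq_mul, AddChar.map_zero_eq_one] at hchar
  linear_combination
    (23 * C * τ + d) ^ 2 * etaPair 1 τ * etaPair 1 (23 * τ) * hchar

lemma etaPair_mul_mobius (a b C d : ℤ) (h : a * d - b * (46 * C) = 1) {τ : ℂ} (hτ : 0 < τ.im) :
    etaPair 23 ((a * τ + b) / (46 * C * τ + d)) *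
        etaPair 23 (2 * ((a * τ + b) / (46 * C * τ + d))) =
      (46 * C * τ + d) ^ 2 * (etaPair 23 τ * etaPair 23 (2 * τ)) := by
  have hsplit : ∀ τ, etaPair 23 τ * etaPair 23 (2 * τ) = etaPair 2 τ * etaPair 2 (23 * τ) :=
    fun τ => by
      simp only [etaPair]
      push_cast
      ring_nf
  have h1 := etaPair_two_mobius a b (23 * C) d (by linear_combination h) hτ
  have h2 := etaPair_two_mobius a (23 * b) C d (by linear_combination h) (im_natCast_mul_pos
    (show 0 < 23 by norm_num) hτ)
  have h23 : (23 : ZMod 8) = -1 := by decide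
  have h46 : (46 : ZMod 8) = -2 := by decide
  have hdet : (a : ZMod 8) * d - -b * (2 * C) = 1 := by
    have := congrArg (Int.cast : ℤ → ZMod 8) h
    push_cast [h46] at this
    linear_combination this
  have hexp := (etaPairTwoExponent_identities _ _ _ _ hdet).2.2
  push_cast [h23] at h1 h2
  simp only [neg_mul, one_mul] at h1 h2
  rw [neg_neg] at hexp
  have h3 := mul_mobius 23 a b (2 * C) d τ
  have harg : (2 : ℂ) * (23 * C) = 46 * C := by ring
  have harg' : (23 : ℂ) * (2 * C) = 46 * C := by ring
  rw [harg] at h1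
  rw [harg'] at h3
  rw [hsplit, hsplit, h1, h3, h2]
  have hchar := congrArg ZMod.stdAddChar hexp
  rw [AddChar.map_add_eq_mul, AddChar.map_zero_eq_one] at hchar
  linear_combination
    (46 * C * τ + d) ^ 2 * etaPair 2 τ * etaPair 2 (23 * τ) * hchar

lemma eulerProd_zero : eulerProd 0 = 1 := by
  simp [eulerProd]

lemma differentiableAt_eulerProd {t : ℂ} (ht : ‖t‖ < 1) : DifferentiableAt ℂ eulerProd t :=
  ModularForm.differentiableOn_tprod_one_sub_pow.differentiableAt
    (Metric.isOpen_ball.mem_nhds (by simpa using ht))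

lemma hasDerivAt_eulerProd_zero : HasDerivAt eulerProd (-1) 0 := by
  have hlog : ∀ n : ℕ, logDeriv (fun t : ℂ => 1 - t ^ (n + 1)) 0 = if n = 0 then -1 else 0 := by
    intro n
    rcases n with _ | n <;> simp [logDeriv_apply]
  have h := logDeriv_tprod_eq_tsum (f := fun (n : ℕ) (t : ℂ) => 1 - t ^ (n + 1))
    Metric.isOpen_ball (Metric.mem_ball_self one_pos) (by simp) (by fun_prop)
    (by
      simp only [hlog]
      exact (hasSum_ite_eq 0 (-1 : ℂ)).summable)
    ModularForm.multipliableLocallyUniformlyOn_one_sub_pow (by simp)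
  simp only [hlog, tsum_ite_eq] at h
  change logDeriv eulerProd 0 = -1 at h
  rw [logDeriv_apply, eulerProd_zero, div_one] at h
  rw [← h]
  exact (differentiableAt_eulerProd (by simp)).hasDerivAt

lemma multipliable_one_sub_pow_odd {t : ℂ} (ht : ‖t‖ < 1) :
    Multipliable fun n : ℕ => 1 - t ^ (2 * n + 1) := by
  apply multipliable_one_add_of_summable (f := fun n => -t ^ (2 * n + 1))
  simpa [Function.comp_def] using (summable_geometric_of_lt_one (norm_nonneg _) ht).comp_injective
    (i := fun n : ℕ => 2 * n + 1) (fun m n h => by simpa using h)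

lemma eulerProd_eq_odd_mul {t : ℂ} (ht : ‖t‖ < 1) :
    eulerProd t = (∏' n : ℕ, (1 - t ^ (2 * n + 1))) * eulerProd (t ^ 2) := by
  have ht2 : ‖t ^ 2‖ < 1 := by
    rw [norm_pow]
    exact pow_lt_one₀ (norm_nonneg _) ht two_ne_zero
  have hpow : ∀ n : ℕ, 1 - t ^ (2 * n + 1 + 1) = 1 - (t ^ 2) ^ (n + 1) := fun n => by
    rw [← pow_mul, mul_add_one, add_assoc]
  have h : Multipliable fun n : ℕ => 1 - t ^ (2 * n + 1 + 1) := by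
    simpa only [hpow] using ModularForm.multipliable_one_sub_pow ht2
  have key := tprod_even_mul_odd (f := fun n : ℕ => 1 - t ^ (n + 1))
    (multipliable_one_sub_pow_odd ht) h
  simp only [hpow] at key
  exact key.symm

lemma eulerProd_mul_eulerProd_neg {t : ℂ} (ht : ‖t‖ < 1) :
    eulerProd t * eulerProd (-t) * eulerProd (t ^ 4) = eulerProd (t ^ 2) ^ 3 := by
  have ht2 : ‖t ^ 2‖ < 1 := by
    rw [norm_pow]
    exact pow_lt_one₀ (norm_nonneg _) ht two_ne_zero
  have hn : ‖-t‖ < 1 := by rwa [norm_neg]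
  have hodd : (∏' n : ℕ, (1 - t ^ (2 * n + 1))) * ∏' n : ℕ, (1 - (-t) ^ (2 * n + 1)) =
      ∏' n : ℕ, (1 - (t ^ 2) ^ (2 * n + 1)) := by
    rw [← (multipliable_one_sub_pow_odd ht).tprod_mul (multipliable_one_sub_pow_odd hn)]
    refine tprod_congr fun n => ?_
    rw [Odd.neg_pow ⟨n, rfl⟩]
    ring
  have h1 := eulerProd_eq_odd_mul ht
  have h2 := eulerProd_eq_odd_mul hn
  have h3 := eulerProd_eq_odd_mul ht2
  rw [neg_sq] at h2
  rw [← pow_mul] at h3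
  rw [← hodd] at h3
  rw [h1, h2]
  linear_combination -eulerProd (t ^ 2) ^ 2 * h3

/-- The `q`-expansion of `η(τ)η(23τ)`. -/
def etaPairSeries (q : ℂ) : ℂ := q * (eulerProd q * eulerProd (q ^ 23))

lemma etaPairSeries_prod {t : ℂ} (ht : ‖t‖ < 1) :
    etaPairSeries t * etaPairSeries (-t) * etaPairSeries (t ^ 4) = -etaPairSeries (t ^ 2) ^ 3 := by
  have ht23 : ‖t ^ 23‖ < 1 := by
    rw [norm_pow]
    exact pow_lt_one₀ (norm_nonneg _) ht (by norm_num)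
  have h1 := eulerProd_mul_eulerProd_neg ht
  have h2 := eulerProd_mul_eulerProd_neg ht23
  have hneg : (-t) ^ 23 = -t ^ 23 := by ring
  simp only [etaPairSeries, hneg, pow_right_comm t _ 23]
  linear_combination -t ^ 6 * eulerProd (t ^ 23) * eulerProd (-t ^ 23) *
    eulerProd ((t ^ 23) ^ 4) * h1 - t ^ 6 * eulerProd (t ^ 2) ^ 3 * h2

open Filter Topology in
lemma tendsto_etaPairSeries_div : Tendsto (fun t => -(etaPairSeries t + etaPairSeries (-t) +
    2 * etaPairSeries (t ^ 4)) / etaPairSeries (t ^ 2)) (𝓝[≠] 0) (𝓝 2) := by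
  set D : ℂ → ℂ := fun t => eulerProd t * eulerProd (t ^ 23) with hDdef
  have hD : HasDerivAt D (-1) 0 := by
    have h1 := hasDerivAt_eulerProd_zero
    have h2 : HasDerivAt (fun t : ℂ => eulerProd (t ^ 23)) (-1 * (23 * 0 ^ 22 * 1)) 0 := by
      refine HasDerivAt.comp (h₂ := eulerProd) 0 ?_ ((hasDerivAt_id (0 : ℂ)).fun_pow 23)
      simpa using h1
    simpa [eulerProd_zero] using h1.fun_mul h2
  have hD0 : D 0 = 1 := by simp [hDdef, eulerProd_zero]
  have hpow : ∀ n ≠ 0, Tendsto (fun t : ℂ => D (t ^ n)) (𝓝[≠] 0) (𝓝 1) := fun n hn => by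
    have hc : ContinuousAt (fun t : ℂ => D (t ^ n)) 0 := by
      refine ContinuousAt.comp (g := D) ?_ (by fun_prop)
      simpa [hn] using hD.continuousAt
    have := hc.tendsto
    simp only [ne_eq, hn, not_false_eq_true, zero_pow, hD0] at this
    exact this.mono_left nhdsWithin_le_nhds
  have hdiff : HasDerivAt (fun t => D t - D (-t)) (-2) 0 := by
    have h1 : HasDerivAt (fun t => D (-t)) (-1 * -1) 0 := by
      refine HasDerivAt.comp (h₂ := D) 0 ?_ (hasDerivAt_neg 0)
      simpa using hD
    rw [show (-2 : ℂ) = -1 - -1 * -1 by norm_num]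
    exact hD.fun_sub h1
  have hslope := hdiff.tendsto_slope
  have ht : Tendsto (fun t : ℂ => t ^ 2) (𝓝[≠] 0) (𝓝 0) := by
    have h : ContinuousAt (fun t : ℂ => t ^ 2) 0 := by fun_prop
    simpa [ContinuousAt] using h.tendsto.mono_left (nhdsWithin_le_nhds (s := {0}ᶜ))
  have hlim := ((hslope.add ((ht.mul (hpow 4 (by norm_num))).const_mul 2)).neg).div
    (hpow 2 two_ne_zero) one_ne_zero
  norm_num at hlim
  refine hlim.congr' ?_
  filter_upwards [self_mem_nhdsWithin] with t ht0
  have ht0 : t ≠ 0 := ht0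
  have hser : ∀ q, etaPairSeries q = q * D q := fun q => rfl
  simp only [Pi.div_apply, slope, hser, vsub_eq_sub, sub_zero, neg_zero, sub_self, smul_eq_mul]
  rcases eq_or_ne (D (t ^ 2)) 0 with h | h
  · simp [h]
  · field_simp
    ring

lemma etaPair_add_one' (τ : ℂ) : etaPair 23 (τ + 1) = etaPair 23 τ := by
  rw [etaPair_add_one, ← exp_nat_mul]
  norm_num [mul_div_cancel₀]

lemma qq_nat_mul (n : ℕ) (τ : ℂ) : qq (n * τ) = qq τ ^ n := by
  rw [qq, qq, ← exp_nat_mul]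
  ring_nf

lemma etaPair_eq_series (τ : ℂ) : etaPair 23 τ = etaPairSeries (qq τ) := by
  have h : exp (2 * ↑Real.pi * I * τ / 24) * exp (2 * ↑Real.pi * I * (23 * τ) / 24) = qq τ := by
    rw [← exp_add, qq]
    ring_nf
  have h23 := qq_nat_mul 23 τ
  push_cast at h23
  rw [etaPair, dedekindEta_eq_eulerProd, dedekindEta_eq_eulerProd, etaPairSeries]
  push_cast
  rw [h23]
  linear_combination eulerProd (qq τ) * eulerProd (qq τ ^ 23) * h

lemma norm_qq_lt_one {τ : ℂ} (hτ : 0 < τ.im) : ‖qq τ‖ < 1 := by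
  rw [qq, norm_exp, Real.exp_lt_one_iff]
  simpa using mul_pos (mul_pos two_pos Real.pi_pos) hτ

lemma qq_half_sq (τ : ℂ) : qq (τ / 2) ^ 2 = qq τ := by
  rw [← qq_nat_mul]
  push_cast
  rw [mul_div_cancel₀ _ two_ne_zero]

lemma qq_two_mul (τ : ℂ) : qq (2 * τ) = qq (τ / 2) ^ 4 := by
  rw [← qq_nat_mul]
  push_cast
  ring_nf

lemma qq_add_one_div_two (τ : ℂ) : qq ((τ + 1) / 2) = -qq (τ / 2) := by
  rw [qq, qq, show 2 * ↑Real.pi * I * ((τ + 1) / 2) = 2 * ↑Real.pi * I * (τ / 2) + Real.pi * I by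
    ring, exp_add, exp_pi_mul_I, mul_neg_one]

/-- The modular function `-2η(2τ)η(46τ) / (η(τ)η(23τ))` for `Γ₀(46)`. -/
def ratioR (τ : ℂ) : ℂ := -2 * etaPair 23 (2 * τ) / etaPair 23 τ

/-- The conjugate of `ratioR` under the Fricke involution of level `23`. -/
def ratioQ (τ : ℂ) : ℂ := -etaPair 23 (τ / 2) / etaPair 23 τ

/-- The translate of `ratioQ` by `1`. -/
def ratioP (τ : ℂ) : ℂ := -etaPair 23 ((τ + 1) / 2) / etaPair 23 τ

lemma im_two_mul_pos {τ : ℂ} (hτ : 0 < τ.im) : 0 < (2 * τ).im := by simpa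

lemma im_div_two_pos {τ : ℂ} (hτ : 0 < τ.im) : 0 < (τ / 2).im := by
  simpa using half_pos hτ

lemma im_add_one_div_two_pos {τ : ℂ} (hτ : 0 < τ.im) : 0 < ((τ + 1) / 2).im :=
  im_div_two_pos (by simpa)

lemma im_fricke_pos {τ : ℂ} (hτ : 0 < τ.im) : 0 < (-1 / (23 * τ)).im := by
  simpa using im_mobius_pos (a := 0) (b := -1) (c := 1) (d := 0) (by norm_num)
    (im_natCast_mul_pos (show 0 < 23 by norm_num) hτ)

lemma etaPair_ne_zero' {τ : ℂ} (hτ : 0 < τ.im) : etaPair 23 τ ≠ 0 :=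
  etaPair_ne_zero (by norm_num) hτ

lemma ratioR_ne_zero {τ : ℂ} (hτ : 0 < τ.im) : ratioR τ ≠ 0 :=
  div_ne_zero (mul_ne_zero (by norm_num) (etaPair_ne_zero' (im_two_mul_pos hτ)))
    (etaPair_ne_zero' hτ)

lemma ratioQ_ne_zero {τ : ℂ} (hτ : 0 < τ.im) : ratioQ τ ≠ 0 :=
  div_ne_zero (neg_ne_zero.mpr (etaPair_ne_zero' (im_div_two_pos hτ))) (etaPair_ne_zero' hτ)

lemma ratioP_add_one (τ : ℂ) : ratioP (τ + 1) = ratioQ τ := by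
  rw [ratioQ, ratioP, etaPair_add_one', show (τ + 1 + 1) / 2 = τ / 2 + 1 by ring,
    etaPair_add_one']

lemma ratioP_mul_ratioQ_mul_ratioR {τ : ℂ} (hτ : 0 < τ.im) :
    ratioP τ * ratioQ τ * ratioR τ = 2 := by
  have h := etaPairSeries_prod (norm_qq_lt_one (im_div_two_pos hτ))
  have h0 := etaPair_ne_zero' hτ
  rw [← qq_add_one_div_two, ← qq_two_mul, qq_half_sq] at h
  simp only [← etaPair_eq_series] at h
  rw [ratioP, ratioQ, ratioR]
  generalize etaPair 23 (2 * τ) = x at *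
  field_simp
  linear_combination -h

lemma ratioR_fricke {τ : ℂ} (hτ : 0 < τ.im) : ratioR (-1 / (23 * τ)) = ratioQ τ := by
  obtain ⟨c, hc, hW⟩ := exists_etaPair_fricke (show 0 < 23 by norm_num)
  have hc0 : c ≠ 0 := by
    rintro rfl
    norm_num at hc
  have h1 := hW τ hτ
  have h2 := hW _ (im_div_two_pos hτ)
  have hτ0 := ne_zero_of_im_pos hτ
  have h0 := etaPair_ne_zero' hτ
  push_cast at h1 h2
  rw [ratioR, ratioQ, h1, show 2 * (-1 / (23 * τ)) = -1 / (23 * (τ / 2)) by field_simp, h2]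
  field_simp

lemma ratioQ_fricke {τ : ℂ} (hτ : 0 < τ.im) : ratioQ (-1 / (23 * τ)) = ratioR τ := by
  rw [← ratioR_fricke (im_fricke_pos hτ)]
  congr 1
  have := ne_zero_of_im_pos hτ
  field_simp

lemma ratioP_fricke {τ : ℂ} (hτ : 0 < τ.im) : ratioP (-1 / (23 * τ)) = ratioP τ := by
  have h1 := ratioP_mul_ratioQ_mul_ratioR (im_fricke_pos hτ)
  rw [ratioQ_fricke hτ, ratioR_fricke hτ] at h1
  have h2 := ratioP_mul_ratioQ_mul_ratioR hτ
  refine mul_right_cancel₀ (mul_ne_zero (ratioQ_ne_zero hτ) (ratioR_ne_zero hτ)) ?_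
  linear_combination h1 - h2

lemma ratioR_lower {τ : ℂ} (hτ : 0 < τ.im) : ratioR (τ / (23 * τ + 1)) = ratioP τ := by
  have hσ : 0 < (-1 / (23 * τ) - 1).im := by simpa using im_fricke_pos hτ
  have hσ0 := ne_zero_of_im_pos hσ
  have hτ0 := ne_zero_of_im_pos hτ
  have hd : 23 * τ + 1 ≠ 0 := by
    simpa using denom_ne_zero_of_det (a := 1) (b := 0) (c := 23) (d := 1) (by norm_num) hτ
  have h : τ / (23 * τ + 1) = -1 / (23 * (-1 / (23 * τ) - 1)) := by
    rw [div_eq_div_iff hd (mul_ne_zero (by norm_num) hσ0)]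
    field_simp
    ring
  rw [h, ratioR_fricke hσ, ← ratioP_add_one, sub_add_cancel, ratioP_fricke hτ]

lemma ratioR_gammaZero {a b C d : ℤ} (h : a * d - b * (46 * C) = 1) {τ : ℂ} (hτ : 0 < τ.im) :
    ratioR ((a * τ + b) / (46 * C * τ + d)) = ratioR τ := by
  have h1 := etaPair_mul_mobius a b C d h hτ
  have h2 := etaPair_sq_mobius a b (2 * C) d (by linear_combination h) hτ
  have hpos := im_mobius_pos (c := 46 * C) h hτ
  have hd := denom_ne_zero_of_det (c := 46 * C) h hτ
  push_cast at h2 hpos hd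
  rw [← mul_assoc, show (23 : ℂ) * 2 = 46 by norm_num] at h2
  have h0 := etaPair_ne_zero' hpos
  have h0' := etaPair_ne_zero' hτ
  rw [ratioR, ratioR, div_eq_div_iff h0 h0']
  refine mul_left_cancel₀ (mul_ne_zero h0 (mul_ne_zero h0' (pow_ne_zero 2 hd))) ?_
  generalize etaPair 23 (2 * ((a * τ + b) / (46 * C * τ + d))) = u at *
  generalize etaPair 23 ((a * τ + b) / (46 * C * τ + d)) = v at *
  linear_combination -2 * (46 * C * τ + d) ^ 2 * etaPair 23 τ ^ 2 * h1 +
    2 * (46 * C * τ + d) ^ 2 * etaPair 23 τ * etaPair 23 (2 * τ) * h2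

lemma ratioR_mobius_of_even {a b C d : ℤ} (h : a * d - b * (23 * C) = 1) (hC : Even C) {τ : ℂ}
    (hτ : 0 < τ.im) : ratioR ((a * τ + b) / (23 * C * τ + d)) = ratioR τ := by
  obtain ⟨k, rfl⟩ := hC
  rw [← ratioR_gammaZero (a := a) (b := b) (C := k) (d := d) (by linear_combination h) hτ]
  push_cast
  ring_nf

lemma ratioR_mobius_of_odd_odd {a b C d : ℤ} (h : a * d - b * (23 * C) = 1) (hC : Odd C)
    (hd : Odd d) {τ : ℂ} (hτ : 0 < τ.im) :
    ratioR ((a * τ + b) / (23 * C * τ + d)) = ratioP τ := by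
  have hpos : 0 < (τ / (23 * τ + 1)).im := by
    simpa using im_mobius_pos (a := 1) (b := 0) (c := 23) (d := 1) (by norm_num) hτ
  have hden : 23 * τ + 1 ≠ 0 := by
    simpa using denom_ne_zero_of_det (a := 1) (b := 0) (c := 23) (d := 1) (by norm_num) hτ
  have hdet : (a - 23 * b) * d - b * (23 * (C - d)) = 1 := by linear_combination h
  have hden' := denom_ne_zero_of_det (c := 23 * (C - d)) hdet hpos
  have hden'' := denom_ne_zero_of_det (c := 23 * C) h hτ
  rw [← ratioR_lower hτ, ← ratioR_mobius_of_even hdet (hC.sub_odd hd) hpos]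
  congr 1
  push_cast at hden' hden'' ⊢
  rw [div_eq_div_iff hden'' hden']
  linear_combination (a * d - 23 * b * C : ℂ) * (div_mul_cancel₀ τ hden).symm

lemma ratioR_mobius_of_odd_even {a b C d : ℤ} (h : a * d - b * (23 * C) = 1) (hC : Odd C)
    (hd : Even d) {τ : ℂ} (hτ : 0 < τ.im) :
    ratioR ((a * τ + b) / (23 * C * τ + d)) = ratioQ τ := by
  have hdet : a * (d - 23 * C) - (b - a) * (23 * C) = 1 := by linear_combination h
  have hodd : Odd (d - 23 * C) := hd.sub_odd ((by decide : Odd (23 : ℤ)).mul hC)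
  rw [← ratioP_add_one, ← ratioR_mobius_of_odd_odd hdet hC hodd (by simpa using hτ)]
  push_cast
  congr 2 <;> ring

lemma ratioR_mobius {a b C d : ℤ} (h : a * d - b * (23 * C) = 1) {τ : ℂ} (hτ : 0 < τ.im) :
    ratioR ((a * τ + b) / (23 * C * τ + d)) =
      if Even C then ratioR τ else if Even d then ratioQ τ else ratioP τ := by
  split_ifs with hC hd
  · exact ratioR_mobius_of_even h hC hτ
  · exact ratioR_mobius_of_odd_even h (Int.not_even_iff_odd.mp hC) hd hτ
  · exact ratioR_mobius_of_odd_odd h (Int.not_even_iff_odd.mp hC) (Int.not_even_iff_odd.mp hd) hτ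

lemma ratioP_mobius {a b C d : ℤ} (h : a * d - b * (23 * C) = 1) {τ : ℂ} (hτ : 0 < τ.im) :
    ratioP ((a * τ + b) / (23 * C * τ + d)) =
      if Even (a + C) then ratioR τ else if Even (b + d) then ratioQ τ else ratioP τ := by
  have hpos := im_mobius_pos (c := 23 * C) h hτ
  have hdet : a * (23 * b + d) - b * (23 * (a + C)) = 1 := by linear_combination h
  have hden := denom_ne_zero_of_det (c := 23 * C) h hτ
  have hden' := denom_ne_zero_of_det (c := 23 * (a + C)) hdet hτ
  have hden'' : 23 * (((a : ℂ) * τ + b) / ((23 * C : ℤ) * τ + d)) + 1 ≠ 0 := by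
    simpa using denom_ne_zero_of_det (a := 1) (b := 0) (c := 23) (d := 1) (by norm_num) hpos
  push_cast at hpos hden hden' hden''
  have hpar : Even (23 * b + d) ↔ Even (b + d) := by
    simp only [Int.even_add, Int.even_mul, show ¬ Even (23 : ℤ) by decide, false_or]
  have hR := ratioR_mobius hdet hτ
  simp only [hpar] at hR
  rw [← ratioR_lower hpos, ← hR]
  congr 1
  push_cast
  rw [div_eq_div_iff hden'' hden']
  linear_combination div_mul_cancel₀ ((a : ℂ) * τ + b) hden

lemma ratioQ_mobius {a b C d : ℤ} (h : a * d - b * (23 * C) = 1) {τ : ℂ} (hτ : 0 < τ.im) :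
    ratioQ ((a * τ + b) / (23 * C * τ + d)) =
      if Even a then ratioR τ else if Even b then ratioQ τ else ratioP τ := by
  have hden := denom_ne_zero_of_det (c := 23 * C) h hτ
  have hdet : (a + 23 * C) * d - (b + d) * (23 * C) = 1 := by linear_combination h
  have ha : Even (a + 23 * C + C) ↔ Even a := by
    rw [show a + 23 * C + C = a + 2 * (12 * C) by ring]
    simp [Int.even_add]
  have hb : Even (b + d + d) ↔ Even b := by
    rw [add_assoc]
    simp [Int.even_add]
  have hP := ratioP_mobius hdet hτ
  simp only [ha, hb] at hP
  rw [← ratioP_add_one, ← hP]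
  push_cast at hden ⊢
  rw [div_add_one hden]
  congr 2
  ring

/-- The sum of the three ratios. -/
def ratioSum (τ : ℂ) : ℂ := ratioP τ + ratioQ τ + ratioR τ

/-- The second elementary symmetric function of the three ratios. -/
def ratioSymm (τ : ℂ) : ℂ := ratioP τ * ratioQ τ + ratioP τ * ratioR τ + ratioQ τ * ratioR τ

lemma ratioSum_ratioSymm_mobius {a b C d : ℤ} (h : a * d - b * (23 * C) = 1) {τ : ℂ}
    (hτ : 0 < τ.im) :
    ratioSum ((a * τ + b) / (23 * C * τ + d)) = ratioSum τ ∧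
    ratioSymm ((a * τ + b) / (23 * C * τ + d)) = ratioSymm τ := by
  have hodd : ¬ Even (a * d - b * (23 * C)) := by
    rw [h]
    decide
  simp only [Int.even_sub, Int.even_mul, show ¬ Even (23 : ℤ) by decide, false_or] at hodd
  simp only [ratioSum, ratioSymm, ratioP_mobius h hτ, ratioQ_mobius h hτ, ratioR_mobius h hτ,
    Int.even_add]
  by_cases ha : Even a <;> by_cases hb : Even b <;> by_cases hC : Even C <;>
    by_cases hd : Even d <;>
    simp only [ha, hb, hC, hd, iff_true, iff_false, not_true_eq_false, if_true,
      if_false] at hodd ⊢ <;>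
    first
    | exact absurd hodd (by decide)
    | exact ⟨by ring1, by ring1⟩
    | exact ⟨trivial, trivial⟩

lemma eventually_im_pos : ∀ᶠ τ : ℂ in Filter.comap im Filter.atTop, 0 < τ.im :=
  Filter.tendsto_comap.eventually (Filter.eventually_gt_atTop 0)

lemma tendsto_add_div_comap_im (j N : ℕ) (hN : 0 < N) :
    Filter.Tendsto (fun τ : ℂ => (τ + j) / N) (Filter.comap im Filter.atTop)
      (Filter.comap im Filter.atTop) := by
  rw [Filter.tendsto_comap_iff]
  have : (im ∘ fun τ : ℂ => (τ + j) / N) = fun τ : ℂ => τ.im / N := by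
    ext τ
    simp
  rw [this]
  exact Filter.tendsto_comap.atTop_div_const (by exact_mod_cast hN)

lemma exists_cusp_width_shift {c : ℤ} (hc : ¬ 23 ∣ c) (d : ℤ) :
    ∃ (j : ℕ) (e : ℤ), d - c * j = 23 * e := by
  have hp : Prime (23 : ℤ) := Nat.prime_iff_prime_int.mp (by norm_num : Nat.Prime 23)
  obtain ⟨u, v, huv⟩ := (hp.coprime_iff_not_dvd).mpr hc
  refine ⟨(v * d % 23).toNat, u * d + c * (v * d / 23), ?_⟩
  rw [Int.toNat_of_nonneg (Int.emod_nonneg _ (by norm_num)), Int.emod_def]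
  linear_combination -d * huv

/-- A function that transforms with weight `k` under `Γ₀(23)` and under the Fricke involution, and
has a limit at `i∞`, has a limit at every cusp. -/
lemma tendsto_slash {G : ℂ → ℂ} {k : ℕ} {κ L : ℂ}
    (hG : ∀ a b C d : ℤ, a * d - b * (23 * C) = 1 → ∀ τ : ℂ, 0 < τ.im →
      G ((a * τ + b) / (23 * C * τ + d)) = (23 * C * τ + d) ^ k * G τ)
    (hW : ∀ τ : ℂ, 0 < τ.im → G (-1 / (23 * τ)) = κ * τ ^ k * G τ)
    (hL : Filter.Tendsto G (Filter.comap im Filter.atTop) (nhds L))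
    {a b c d : ℤ} (h : a * d - b * c = 1) :
    ∃ m : ℂ, Filter.Tendsto (fun τ : ℂ => ((c * τ + d) ^ k)⁻¹ * G ((a * τ + b) / (c * τ + d)))
      (Filter.comap im Filter.atTop) (nhds (m * L)) := by
  by_cases hc : 23 ∣ c
  · obtain ⟨C, rfl⟩ := hc
    refine ⟨1, ?_⟩
    rw [one_mul]
    refine hL.congr' ?_
    filter_upwards [eventually_im_pos] with τ hτ
    have hd := denom_ne_zero_of_det h hτ
    push_cast at hd ⊢
    rw [hG a b C d h τ hτ, inv_mul_cancel_left₀ (pow_ne_zero k hd)]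
  · obtain ⟨j, e, hj⟩ := exists_cusp_width_shift hc d
    refine ⟨κ / 23 ^ k, ((hL.comp (tendsto_add_div_comap_im j 23 (by norm_num))).const_mul _).congr'
      ?_⟩
    filter_upwards [eventually_im_pos] with τ hτ
    have hd := denom_ne_zero_of_det h hτ
    have hτj : 0 < ((τ + j) / 23).im := by simpa using hτ
    have hτj0 := ne_zero_of_im_pos hτj
    have hτj1 : τ + j ≠ 0 := fun h0 => hτj0 (by rw [h0, zero_div])
    have hσ := im_fricke_pos hτj
    have hσ1 : -1 / (23 * ((τ + j) / 23)) = -1 / (τ + j) := by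
      rw [mul_div_cancel₀ _ (by norm_num : (23 : ℂ) ≠ 0)]
    have hdet : (a * j - b) * c - a * (23 * (-e)) = 1 := by linear_combination h - a * hj
    have hden := denom_ne_zero_of_det hdet hσ
    have hj' : (d : ℂ) - c * j = 23 * e := by exact_mod_cast hj
    have hmul := hG _ _ _ _ hdet _ hσ
    rw [hW _ hτj] at hmul
    rw [hσ1] at hmul hden
    push_cast at hmul hden
    have hden2 : 23 * (-(e : ℂ)) * (-1 / (τ + j)) + c = (c * τ + d) / (τ + j) := by
      field_simp
      linear_combination -hj'
    have harg : ((a * j - b) * (-1 / (τ + j)) + a) / (23 * (-(e : ℂ)) * (-1 / (τ + j)) + c)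
        = (a * τ + b) / (c * τ + d) := by
      rw [hden2]
      field_simp
      ring
    rw [harg, hden2] at hmul
    rw [hmul]
    simp only [Function.comp_apply, Nat.cast_ofNat, div_pow]
    generalize c * τ + d = X at hd ⊢
    field_simp

lemma tendsto_qq : Filter.Tendsto qq (Filter.comap im Filter.atTop) (nhdsWithin 0 {0}ᶜ) := by
  rw [tendsto_nhdsWithin_iff]
  refine ⟨?_, Filter.Eventually.of_forall fun τ => exp_ne_zero _⟩
  rw [tendsto_zero_iff_norm_tendsto_zero]
  have hnorm : (fun τ => ‖qq τ‖) = fun τ : ℂ => Real.exp (-(2 * Real.pi * τ.im)) := by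
    ext τ
    simp [qq, norm_exp]
  rw [hnorm]
  exact Real.tendsto_exp_neg_atTop_nhds_zero.comp
    (Filter.tendsto_comap.const_mul_atTop (by positivity))

lemma tendsto_qq_half :
    Filter.Tendsto (fun τ => qq (τ / 2)) (Filter.comap im Filter.atTop) (nhdsWithin 0 {0}ᶜ) := by
  simpa [Function.comp_def] using tendsto_qq.comp (tendsto_add_div_comap_im 0 2 two_pos)

lemma tendsto_ratioSum : Filter.Tendsto ratioSum (Filter.comap im Filter.atTop) (nhds 2) := by
  refine (tendsto_etaPairSeries_div.comp tendsto_qq_half).congr fun τ => ?_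
  rw [Function.comp_apply, ← qq_add_one_div_two, ← qq_two_mul, qq_half_sq]
  simp only [← etaPair_eq_series]
  rw [ratioSum, ratioP, ratioQ, ratioR]
  ring

lemma differentiableAt_ratioSum {τ : ℂ} (hτ : 0 < τ.im) : DifferentiableAt ℂ ratioSum τ := by
  have h {g : ℂ → ℂ} (hg : DifferentiableAt ℂ g τ) (hpos : 0 < (g τ).im) :
      DifferentiableAt ℂ (fun τ => etaPair 23 (g τ)) τ :=
    (differentiableAt_etaPair (by norm_num) hpos).comp τ hg
  have h0 := etaPair_ne_zero' hτ
  have h1 := h differentiableAt_fun_id hτ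
  exact (((h (by fun_prop) (im_add_one_div_two_pos hτ)).neg.div h1 h0).add
    ((h (by fun_prop) (im_div_two_pos hτ)).neg.div h1 h0)).add
    (((h (by fun_prop) (im_two_mul_pos hτ)).const_mul (-2)).div h1 h0)

lemma ratioSum_fricke {τ : ℂ} (hτ : 0 < τ.im) : ratioSum (-1 / (23 * τ)) = ratioSum τ := by
  rw [ratioSum, ratioSum, ratioP_fricke hτ, ratioQ_fricke hτ, ratioR_fricke hτ]
  ring

lemma ratioSymm_fricke {τ : ℂ} (hτ : 0 < τ.im) : ratioSymm (-1 / (23 * τ)) = ratioSymm τ := by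
  rw [ratioSymm, ratioSymm, ratioP_fricke hτ, ratioQ_fricke hτ, ratioR_fricke hτ]
  ring

lemma comp_smul_eq (G : ℂ → ℂ) (γ : Matrix.SpecialLinearGroup (Fin 2) ℤ) (z : UpperHalfPlane) :
    G (γ • z : UpperHalfPlane) = G (((γ.1 0 0 : ℂ) * z + (γ.1 0 1 : ℂ)) /
      ((γ.1 1 0 : ℂ) * z + (γ.1 1 1 : ℂ))) := by
  rw [UpperHalfPlane.coe_specialLinearGroup_apply]
  simp

lemma det_fin_two_eq_one (γ : Matrix.SpecialLinearGroup (Fin 2) ℤ) :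
    γ.1 0 0 * γ.1 1 1 - γ.1 0 1 * γ.1 1 0 = 1 := by
  rw [← Matrix.det_fin_two, γ.2]

open scoped ModularForm in
/-- `ratioSum` as a modular function for `Γ₀(23)` without poles. -/
def ratioSumForm :
    ModularForm ((CongruenceSubgroup.Gamma0 23).map (Matrix.SpecialLinearGroup.mapGL ℝ)) 0 where
  toFun z := ratioSum z
  slash_action_eq' A hA := by
    obtain ⟨γ, hγ, rfl⟩ := hA
    ext z
    change ((fun z : UpperHalfPlane => ratioSum z) ∣[(0 : ℤ)] γ) z = _
    rw [ModularForm.SL_slash_apply, neg_zero, zpow_zero, mul_one, comp_smul_eq ratioSum]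
    obtain ⟨C, hC⟩ := (ZMod.intCast_zmod_eq_zero_iff_dvd _ 23).mp
      (CongruenceSubgroup.Gamma0_mem.mp hγ)
    have hdet := det_fin_two_eq_one γ
    rw [hC] at hdet ⊢
    push_cast at hdet ⊢
    exact (ratioSum_ratioSymm_mobius hdet z.im_pos).1
  holo' := by
    rw [UpperHalfPlane.mdifferentiable_iff]
    refine .congr (fun z hz => (differentiableAt_ratioSum hz).differentiableWithinAt)
      fun z hz => ?_
    simp [UpperHalfPlane.ofComplex_apply_of_im_pos hz]
  bdd_at_cusps' hc := by
    rw [Subgroup.IsArithmetic.isCusp_iff_isCusp_SL2Z] at hc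
    rw [OnePoint.isBoundedAt_iff_forall_SL2Z hc]
    intro γ _
    obtain ⟨m, hm⟩ := tendsto_slash (k := 0) (κ := 1)
      (fun a b C d h τ hτ => by simpa using (ratioSum_ratioSymm_mobius h hτ).1)
      (fun τ hτ => by simpa using ratioSum_fricke hτ) tendsto_ratioSum (det_fin_two_eq_one γ)
    have hcoe : Filter.Tendsto ((↑) : UpperHalfPlane → ℂ) UpperHalfPlane.atImInfty
        (Filter.comap im Filter.atTop) := Filter.tendsto_comap_iff.mpr Filter.tendsto_comap
    refine ((hm.comp hcoe).congr fun z => ?_).isBigO_one ℝ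
    rw [ModularForm.SL_slash_apply, neg_zero, zpow_zero, mul_one, comp_smul_eq ratioSum]
    simp

lemma ratioSum_eq_two {τ : ℂ} (hτ : 0 < τ.im) : ratioSum τ = 2 := by
  obtain ⟨c, hc⟩ := ModularForm.eq_const_of_weight_zero ratioSumForm
  have hconst {τ : ℂ} (hτ : 0 < τ.im) : ratioSum τ = c := congrFun hc ⟨τ, hτ⟩
  have hne : (Filter.comap im Filter.atTop).NeBot :=
    Filter.atTop_neBot.comap_of_surj Complex.im_surjective
  rw [hconst hτ]
  refine tendsto_nhds_unique (tendsto_const_nhds.congr' ?_) tendsto_ratioSum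
  filter_upwards [eventually_im_pos] with τ hτ
  exact (hconst hτ).symm

lemma f23a_eq_etaPair (τ : ℂ) :
    f23a τ = etaPair 23 τ ^ 3 / etaPair 23 (2 * τ) + 3 * etaPair 23 τ ^ 2 +
      4 * etaPair 23 τ * etaPair 23 (2 * τ) + 4 * etaPair 23 (2 * τ) ^ 2 := by
  simp only [f23a, etaPair]
  push_cast
  rw [show (23 : ℂ) * (2 * τ) = 46 * τ by ring]
  ring

lemma f23a_eq {τ : ℂ} (hτ : 0 < τ.im) : f23a τ = (3 - ratioSymm τ) * etaPair 23 τ ^ 2 := by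
  have hsum := ratioSum_eq_two hτ
  have hprod := ratioP_mul_ratioQ_mul_ratioR hτ
  have hR := ratioR_ne_zero hτ
  have h0 := etaPair_ne_zero' hτ
  have h2 := etaPair_ne_zero' (im_two_mul_pos hτ)
  have hx : etaPair 23 (2 * τ) = -(ratioR τ * etaPair 23 τ) / 2 := by
    rw [ratioR, div_mul_cancel₀ _ h0]
    ring
  rw [f23a_eq_etaPair, hx]
  rw [ratioSum] at hsum
  rw [ratioSymm]
  field_simp
  linear_combination 4 * hprod + 4 * ratioR τ ^ 2 * hsum

lemma f23a_mobius {a b C d : ℤ} (h : a * d - b * (23 * C) = 1) {τ : ℂ} (hτ : 0 < τ.im) :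
    f23a ((a * τ + b) / (23 * C * τ + d)) = (23 * C * τ + d) ^ 2 * f23a τ := by
  have hpos := im_mobius_pos (c := 23 * C) h hτ
  push_cast at hpos
  rw [f23a_eq hpos, f23a_eq hτ, (ratioSum_ratioSymm_mobius h hτ).2, etaPair_sq_mobius a b C d h hτ]
  ring

lemma f23a_fricke {τ : ℂ} (hτ : 0 < τ.im) : f23a (-1 / (23 * τ)) = -23 * τ ^ 2 * f23a τ := by
  obtain ⟨c, hc, hW⟩ := exists_etaPair_fricke (show 0 < 23 by norm_num)
  have h1 := hW τ hτ
  push_cast at h1 hc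
  rw [f23a_eq (im_fricke_pos hτ), f23a_eq hτ, ratioSymm_fricke hτ, h1, mul_pow, mul_pow, hc]
  ring

lemma differentiableAt_f23a {τ : ℂ} (hτ : 0 < τ.im) : DifferentiableAt ℂ f23a τ := by
  have h1 : DifferentiableAt ℂ (etaPair 23) τ := differentiableAt_etaPair (by norm_num) hτ
  have h2 : DifferentiableAt ℂ (fun τ => etaPair 23 (2 * τ)) τ :=
    (differentiableAt_etaPair (by norm_num) (im_two_mul_pos hτ)).comp τ (by fun_prop)
  have h0 := etaPair_ne_zero' (im_two_mul_pos hτ)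
  rw [funext f23a_eq_etaPair]
  fun_prop (disch := exact h0)

lemma continuousAt_zero_comp_pow {g : ℂ → ℂ} (hg : ContinuousAt g 0) {n : ℕ} (hn : n ≠ 0) :
    ContinuousAt (fun q => g (q ^ n)) 0 :=
  ContinuousAt.comp_of_eq hg (continuousAt_id.pow n) (zero_pow hn)

lemma tendsto_f23a : Filter.Tendsto f23a (Filter.comap im Filter.atTop) (nhds 0) := by
  have hE : ContinuousAt eulerProd 0 := (differentiableAt_eulerProd (by simp)).continuousAt
  have hE2 : ContinuousAt (fun q => eulerProd q * eulerProd (q ^ 23)) 0 :=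
    hE.mul (continuousAt_zero_comp_pow hE (by norm_num))
  have hS : ContinuousAt etaPairSeries 0 := continuousAt_id.mul hE2
  have hS2 := continuousAt_zero_comp_pow hS two_ne_zero
  have hT : ContinuousAt (fun q => q * (eulerProd q * eulerProd (q ^ 23)) ^ 3 /
      (eulerProd (q ^ 2) * eulerProd ((q ^ 2) ^ 23)) + 3 * etaPairSeries q ^ 2 +
      4 * etaPairSeries q * etaPairSeries (q ^ 2) + 4 * etaPairSeries (q ^ 2) ^ 2) 0 :=
    ((((continuousAt_id.mul (hE2.pow 3)).div (continuousAt_zero_comp_pow hE2 two_ne_zero)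
      (by simp [eulerProd_zero])).add ((hS.pow 2).const_mul 3)).add
      ((hS.const_mul 4).mul hS2)).add ((hS2.pow 2).const_mul 4)
  have hlim := hT.tendsto.comp (tendsto_qq.mono_right nhdsWithin_le_nhds)
  simp only [etaPairSeries, zero_mul, zero_div, ne_eq, OfNat.ofNat_ne_zero, not_false_eq_true,
    zero_pow, mul_zero, add_zero] at hlim
  refine hlim.congr fun τ => ?_
  have hq : qq τ ≠ 0 := exp_ne_zero _
  have h2 := qq_nat_mul 2 τ
  push_cast at h2
  rw [f23a_eq_etaPair, etaPair_eq_series, etaPair_eq_series, h2]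
  simp only [Function.comp_apply, etaPairSeries]
  congr 3
  rw [mul_pow (qq τ), show qq τ ^ 3 = qq τ ^ 2 * qq τ by ring, mul_assoc,
    mul_div_mul_left _ _ (pow_ne_zero 2 hq)]

/-- `f_{23,a}` is a cusp form of weight `2` for `Γ₀(23)`: it is holomorphic
on the upper half-plane, transforms with weight `2` under `Γ₀(23)`, and tends to `0` as
`ℑτ → ∞` after slashing by any `γ ∈ SL₂(ℤ)`. -/
theorem stmt_9 :
    (∀ τ : ℂ, 0 < τ.im → DifferentiableAt ℂ f23a τ) ∧
    (∀ γ ∈ CongruenceSubgroup.Gamma0 23, ∀ τ : ℂ, 0 < τ.im →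
      f23a (((γ.1 0 0 : ℂ) * τ + (γ.1 0 1 : ℂ)) / ((γ.1 1 0 : ℂ) * τ + (γ.1 1 1 : ℂ)))
        = ((γ.1 1 0 : ℂ) * τ + (γ.1 1 1 : ℂ)) ^ 2 * f23a τ) ∧
    (∀ γ : Matrix.SpecialLinearGroup (Fin 2) ℤ,
      Filter.Tendsto (fun τ : ℂ => (((γ.1 1 0 : ℂ) * τ + (γ.1 1 1 : ℂ)) ^ 2)⁻¹ *
          f23a (((γ.1 0 0 : ℂ) * τ + (γ.1 0 1 : ℂ)) / ((γ.1 1 0 : ℂ) * τ + (γ.1 1 1 : ℂ))))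
        (Filter.comap Complex.im Filter.atTop) (nhds 0)) := by
  refine ⟨fun τ hτ => differentiableAt_f23a hτ, fun γ hγ τ hτ => ?_, fun γ => ?_⟩
  · obtain ⟨C, hC⟩ := (ZMod.intCast_zmod_eq_zero_iff_dvd _ 23).mp
      (CongruenceSubgroup.Gamma0_mem.mp hγ)
    have hdet := det_fin_two_eq_one γ
    rw [hC] at hdet ⊢
    push_cast at hdet ⊢
    exact f23a_mobius hdet hτ
  · obtain ⟨m, hm⟩ := tendsto_slash (fun a b C d h τ hτ => f23a_mobius h hτ)
      (fun τ hτ => f23a_fricke hτ) tendsto_f23a (det_fin_two_eq_one γ)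
    rwa [mul_zero] at hm
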